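/- Let m, n, N ∈ ℕ, let M ∈ ℝ^{m×m} be diagonal with positive diagonal entries, let Q ∈ ℝ^{m×m} be skew-symmetric with zero row sums, and let V ∈ ℝ^{m×N} be such that VᵀMV is invertible; define the M-weighted projection P = (VᵀMV)⁻¹VᵀM. Let S : ℝⁿ → ℝ be differentiable with gradient v = ∇S, assume v : ℝⁿ → ℝⁿ is a bijection with inverse u_v, let ψ : ℝⁿ → ℝ, and let f_EC be an entropy conservative two-point flux for (v, ψ). Suppose u_N : ℝ → ({1,…,N} → ℝⁿ) is differentiable, and for each t define componentwise the entropy-projected state ũ_i(t) = u_v( (V P v(V u_N(t)))_i ) for i = 1,…,m and the flux matrix F_{ij}(t) = f_EC(ũ_i(t), ũ_j(t)). If u_N satisfies the reduced order model (VᵀMV)·(d/dt)u_N(t) + 2 Vᵀ( (Q ∘ F(t))·𝟙 ) = 0, where (Q ∘ F)·𝟙 denotes the vector with i-th entry Σ_j Q_{ij} F_{ij}, then the total entropy t ↦ Σ_{i=1}^{m} M_{ii} S( (V u_N(t))_i ) has zero derivative, i.e. is constant in time. -/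

import Mathlib

open Matrix
open scoped RealInnerProductSpace

/-- Action of a real matrix on a vector whose entries lie in a real vector space
(the "vector-of-vectors" matrix-vector product). -/
noncomputable def mulVecE {m' n' : Type*} [Fintype n'] {E : Type*}
    [AddCommMonoid E] [Module ℝ E] (A : Matrix m' n' ℝ) (x : n' → E) : m' → E :=
  fun i => ∑ j, A i j • x j

theorem mulVecE_mul {l m n E : Type*} [Fintype m] [Fintype n] [AddCommMonoid E] [Module ℝ E]
    (A : Matrix l m ℝ) (B : Matrix m n ℝ) (x : n → E) :
    mulVecE (A * B) x = mulVecE A (mulVecE B x) := by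
  ext i
  simp only [mulVecE, Matrix.mul_apply, Finset.sum_smul, Finset.smul_sum, mul_smul]
  exact Finset.sum_comm

theorem mulVecE_diagonal {m E : Type*} [Fintype m] [DecidableEq m] [AddCommMonoid E] [Module ℝ E]
    (d : m → ℝ) (x : m → E) (i : m) : mulVecE (Matrix.diagonal d) x i = d i • x i := by
  simp [mulVecE, Matrix.diagonal_apply, ite_smul]

theorem sum_inner_mulVecE {m n E : Type*} [Fintype m] [Fintype n] [NormedAddCommGroup E]
    [InnerProductSpace ℝ E] (A : Matrix m n ℝ) (x : m → E) (y : n → E) :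
    ∑ i, ⟪x i, mulVecE A y i⟫ = ∑ k, ⟪mulVecE Aᵀ x k, y k⟫ := by
  simp only [mulVecE, inner_sum, sum_inner, real_inner_smul_left, real_inner_smul_right,
    Matrix.transpose_apply]
  exact Finset.sum_comm

/-- The entropy production of flux differencing with a skew-symmetric matrix with zero row sums
vanishes. -/
theorem sum_inner_flux_eq_zero {m E : Type*} [Fintype m] [NormedAddCommGroup E]
    [InnerProductSpace ℝ E] (Q : Matrix m m ℝ) (hskew : Qᵀ = -Q)
    (hrow : Q *ᵥ (fun _ => (1 : ℝ)) = 0) (w : m → E) (F : m → m → E) (p : m → ℝ)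
    (hsymm : ∀ i j, F i j = F j i) (hp : ∀ i j, ⟪w i - w j, F i j⟫ = p i - p j) :
    ∑ i, ⟪w i, ∑ j, Q i j • F i j⟫ = 0 := by
  have hQ : ∀ i j, Q j i = -Q i j := fun i j => congrFun (congrFun hskew i) j
  have hr : ∀ i, ∑ j, Q i j = 0 := fun i => by
    simpa [Matrix.mulVec, dotProduct] using congrFun hrow i
  have hc : ∀ j, ∑ i, Q i j = 0 := fun j => by
    rw [Finset.sum_congr rfl fun i _ => hQ j i, Finset.sum_neg_distrib, hr, neg_zero]
  have hswap : ∑ i, ∑ j, Q i j * ⟪w i, F i j⟫ = -∑ i, ∑ j, Q i j * ⟪w j, F i j⟫ := by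
    rw [Finset.sum_comm, ← Finset.sum_neg_distrib]
    refine Finset.sum_congr rfl fun i _ => ?_
    rw [← Finset.sum_neg_distrib]
    refine Finset.sum_congr rfl fun j _ => ?_
    rw [hQ i j, hsymm j i, neg_mul]
  have hdiff : ∑ i, ∑ j, Q i j * ⟪w i, F i j⟫ - ∑ i, ∑ j, Q i j * ⟪w j, F i j⟫ =
      ∑ i, ∑ j, Q i j * p i - ∑ i, ∑ j, Q i j * p j := by
    simp only [← Finset.sum_sub_distrib, ← mul_sub, ← inner_sub_left, hp]
  have hpi : ∑ i, ∑ j, Q i j * p i = 0 := by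
    simp only [← Finset.sum_mul, hr, zero_mul, Finset.sum_const_zero]
  have hpj : ∑ i, ∑ j, Q i j * p j = 0 := by
    rw [Finset.sum_comm]
    simp only [← Finset.sum_mul, hc, zero_mul, Finset.sum_const_zero]
  simp only [inner_sum, real_inner_smul_right]
  linarith

theorem hasDerivAt_mulVecE {m n E : Type*} [Fintype n] [NormedAddCommGroup E] [NormedSpace ℝ E]
    (A : Matrix m n ℝ) {x : ℝ → n → E} {x' : n → E} {t : ℝ}
    (hx : ∀ k, HasDerivAt (fun s => x s k) (x' k) t) (i : m) :
    HasDerivAt (fun s => mulVecE A (x s) i) (mulVecE A x' i) t :=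
  HasDerivAt.fun_sum fun k _ => (hx k).const_smul (A i k)

/-- Semi-discrete entropy conservation for the Galerkin reduced order model with
entropy projection (Theorem `thm:DG_1D_ROM_ES`). -/
theorem stmt3 (m n N : ℕ)
    (Md : Fin m → ℝ) (hMd : ∀ i, 0 < Md i)
    (Q : Matrix (Fin m) (Fin m) ℝ)
    (hskew : Qᵀ = -Q) (hrow : Q *ᵥ (fun _ => (1 : ℝ)) = 0)
    (V : Matrix (Fin m) (Fin N) ℝ)
    (hinv : IsUnit (Vᵀ * Matrix.diagonal Md * V))
    (P : Matrix (Fin N) (Fin m) ℝ)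
    (hP : P = (Vᵀ * Matrix.diagonal Md * V)⁻¹ * Vᵀ * Matrix.diagonal Md)
    (S : EuclideanSpace ℝ (Fin n) → ℝ)
    (v uv : EuclideanSpace ℝ (Fin n) → EuclideanSpace ℝ (Fin n))
    (hS : ∀ x, HasGradientAt S (v x) x)
    (hleft : Function.LeftInverse uv v) (hright : Function.RightInverse uv v)
    (ψ : EuclideanSpace ℝ (Fin n) → ℝ)
    (fEC : EuclideanSpace ℝ (Fin n) → EuclideanSpace ℝ (Fin n) → EuclideanSpace ℝ (Fin n))
    (hsymm : ∀ uL uR, fEC uL uR = fEC uR uL)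
    (hEC : ∀ uL uR, ⟪v uL - v uR, fEC uL uR⟫ = ψ uL - ψ uR)
    (uN uN' : ℝ → Fin N → EuclideanSpace ℝ (Fin n))
    (huN : ∀ k t, HasDerivAt (fun s => uN s k) (uN' t k) t)
    -- the entropy-projected states
    (util : ℝ → Fin m → EuclideanSpace ℝ (Fin n))
    (hutil : ∀ t i, util t i =
      uv (mulVecE (V * P) (fun j => v (mulVecE V (uN t) j)) i))
    -- the flux matrix
    (F : ℝ → Fin m → Fin m → EuclideanSpace ℝ (Fin n))
    (hF : ∀ t i j, F t i j = fEC (util t i) (util t j))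
    -- the reduced order model
    (hROM : ∀ t k,
      mulVecE (Vᵀ * Matrix.diagonal Md * V) (uN' t) k
        + (2 : ℝ) • mulVecE Vᵀ (fun i => ∑ j, Q i j • F t i j) k = 0) :
    ∀ t, HasDerivAt (fun s => ∑ i, Md i * S (mulVecE V (uN s) i)) 0 t := by
  intro t
  set G := Vᵀ * Matrix.diagonal Md * V with hG
  set y : Fin m → EuclideanSpace ℝ (Fin n) := fun j => v (mulVecE V (uN t) j)
  set w := mulVecE P y
  have hGP : G * P = Vᵀ * Matrix.diagonal Md := by
    rw [hP, Matrix.mul_assoc G⁻¹, Matrix.mul_nonsing_inv_cancel_left _ _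
      ((Matrix.isUnit_iff_isUnit_det G).mp hinv)]
  have hGT : Gᵀ = G := by
    simp [hG, Matrix.transpose_mul, Matrix.mul_assoc]
  have hw : ∀ i, v (util t i) = mulVecE V w i := fun i => by
    rw [hutil, hright, mulVecE_mul]
  have hflux : ∑ i, ⟪mulVecE V w i, ∑ j, Q i j • F t i j⟫ = 0 :=
    sum_inner_flux_eq_zero Q hskew hrow _ (F t) (fun i => ψ (util t i))
      (fun i j => by rw [hF, hF, hsymm]) (fun i j => by rw [← hw, ← hw, hF, hEC])
  have hderiv : HasDerivAt (fun s => ∑ i, Md i * S (mulVecE V (uN s) i))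
      (∑ i, Md i * ⟪y i, mulVecE V (uN' t) i⟫) t :=
    HasDerivAt.fun_sum fun i _ => HasDerivAt.const_mul (Md i) <| by
      simpa [Function.comp_def] using (hS (mulVecE V (uN t) i)).hasFDerivAt.comp_hasDerivAt t
        (hasDerivAt_mulVecE V (fun k => huN k t) i)
  convert hderiv using 1
  symm
  calc ∑ i, Md i * ⟪y i, mulVecE V (uN' t) i⟫
      = ∑ i, ⟪mulVecE (Matrix.diagonal Md) y i, mulVecE V (uN' t) i⟫ := by
        simp only [mulVecE_diagonal, real_inner_smul_left]
    _ = ∑ k, ⟪mulVecE Gᵀ w k, uN' t k⟫ := by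
        rw [sum_inner_mulVecE, ← mulVecE_mul, ← hGP, mulVecE_mul, hGT]
    _ = ∑ k, ⟪w k, -((2 : ℝ) • mulVecE Vᵀ (fun i => ∑ j, Q i j • F t i j) k)⟫ := by
        rw [← sum_inner_mulVecE]
        simp only [fun k => eq_neg_of_add_eq_zero_left (hROM t k)]
    _ = -(2 * ∑ i, ⟪mulVecE V w i, ∑ j, Q i j • F t i j⟫) := by
        simp only [inner_neg_right, real_inner_smul_right, Finset.sum_neg_distrib,
          ← Finset.mul_sum, sum_inner_mulVecE, Matrix.transpose_transpose]
    _ = 0 := by rw [hflux, mul_zero, neg_zero]
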